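/- arXiv:1306.2054 — 2 statements merged into one kernel-verified Lean document; each statement's English description precedes it below -/
import Mathlib

section
/- If ω is an irreducible word, then the symmetric subshift Σ_ω is a transitive subshift of finite type. -/
open Filter Topology

namespace Paper

/-- One-sided infinite binary sequences (indexed from 0): the space Σ₂. -/
abbrev Seq := ℕ → Bool

/-- The one-sided shift map σ. -/
def shift (x : Seq) : Seq := fun i => x (i + 1)

/-- The mirror image x̄ of a sequence. -/
def mirror (x : Seq) : Seq := fun i => !x i

/-- Strict lexicographic order: x ≺ y iff x k < y k at the first index k where they differ. -/
def lexLt (x y : Seq) : Prop := ∃ k, (∀ i < k, x i = y i) ∧ x k < y k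

/-- Non-strict lexicographic order. -/
def lexLe (x y : Seq) : Prop := lexLt x y ∨ x = y

/-- The symmetric subshift Σ_a = {x : ā ≺ σⁿ x ≺ a for all n ≥ 0}. -/
def SigmaA (a : Seq) : Set Seq :=
  {x | ∀ n : ℕ, lexLt (mirror a) (shift^[n] x) ∧ lexLt (shift^[n] x) a}

/-- A finite word identified with the sequence ω0^∞. -/
def wordSeq (w : List Bool) : Seq := fun i => w.getD i false

/-- The word w occurs in the sequence x. -/
def occursIn (w : List Bool) (x : Seq) : Prop :=
  ∃ i, ∀ j < w.length, x (i + j) = w.getD j false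

/-- B_n(Σ): admissible words of length n. -/
def Bword (S : Set Seq) (n : ℕ) : Set (List Bool) :=
  {w | w.length = n ∧ ∃ x ∈ S, occursIn w x}

/-- The language L(Σ) = ⋃_{n ≥ 1} B_n(Σ). -/
def lang (S : Set Seq) : Set (List Bool) :=
  {w | 1 ≤ w.length ∧ ∃ x ∈ S, occursIn w x}

/-- Transitivity: every ordered pair of admissible words can be bridged. -/
def IsTransitiveShift (S : Set Seq) : Prop :=
  ∀ u ∈ lang S, ∀ v ∈ lang S, ∃ w : List Bool, (u ++ w ++ v) ∈ lang S

/-- Specification: bridges can be chosen of a fixed length m. -/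
def HasSpecification (S : Set Seq) : Prop :=
  ∃ m : ℕ, ∀ u ∈ lang S, ∀ v ∈ lang S,
    ∃ w : List Bool, w.length = m ∧ (u ++ w ++ v) ∈ lang S

/-- Subshift of finite type: defined by a finite set of forbidden words of equal length. -/
def IsSFT (S : Set Seq) : Prop :=
  ∃ (F : Finset (List Bool)) (n : ℕ), (∀ w ∈ F, w.length = n) ∧
    S = {x : Seq | ∀ w ∈ F, ¬ occursIn w x}

/-- ω''' = w₁…w_m (w̄₁…w̄_{m-1}1)^∞, with the convention 1''' = 1(01)^∞. -/
def triple (w : List Bool) : Seq :=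
  if w.length ≤ 1 then fun i => decide (i % 2 = 0)
  else fun i =>
    if i < w.length then w.getD i false
    else if (i - w.length) % w.length = w.length - 1 then true
    else !(w.getD ((i - w.length) % w.length) false)

/-- The Thue–Morse sequence t (t 0 = 0, 0-indexed). -/
def thueMorse (n : ℕ) : Bool := decide (((Nat.digits 2 n).count 1) % 2 = 1)

/-- a* = σ(Thue–Morse sequence) = 1101001100101101… . -/
def astar : Seq := fun i => thueMorse (i + 1)

/-- ω_{a*,k}: the word formed by the first 2^k digits of a*. -/
def astarWord (k : ℕ) : List Bool := List.ofFn fun j : Fin (2 ^ k) => astar j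

/-- a is an i-sequence. -/
def IsISequence (i : ℕ) (a : Seq) : Prop :=
  if i = 0 then lexLt (triple (astarWord 1)) a ∧ lexLt a (fun _ => true)
  else lexLt (triple (astarWord (i + 1))) a ∧ lexLe a (triple (astarWord i))

/-- i-irreducible word (indices of letters are 1-based, as in the paper). -/
def IIrreducible (i : ℕ) (w : List Bool) : Prop :=
  w ≠ [] ∧ w.getLast? = some true ∧ IsISequence i (wordSeq w) ∧
    ∀ j, 2 ^ i < j → j < w.length → w.getD (j - 1) false = true →
      lexLt (triple (w.take j)) (wordSeq w)

/-- Irreducible word. -/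
def IrredWord (w : List Bool) : Prop :=
  w ≠ [] ∧ w.getD 0 false = true ∧ w.getLast? = some true ∧
    ∀ k, 1 ≤ k → k < w.length → w.getD (k - 1) false = true →
      lexLt (triple (w.take k)) (wordSeq w)

/-- Topological entropy h_top(Σ) = lim (1/n) log₂ |B_n(Σ)| (stated via limsup;
the limit exists by subadditivity, so this agrees with the limit). -/
noncomputable def htop (S : Set Seq) : ℝ :=
  Filter.limsup (fun n : ℕ => Real.logb 2 ((Bword S n).ncard) / (n : ℝ)) Filter.atTop

/-- The sequence (10)^∞. -/
def tenSeq : Seq := fun i => decide (i % 2 = 0)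

/-- The sequence 11(01)^∞. -/
def oneoneSeq : Seq := fun i => decide (i = 0 ∨ i % 2 = 1)

/-- Complete invariance of A inside S: σ(A) = A = σ⁻¹(A) ∩ S. -/
def CompletelyInvariant (S A : Set Seq) : Prop :=
  shift '' A = A ∧ shift ⁻¹' A ∩ S = A

/-- Transitive component of a subshift S. -/
def IsTransitiveComponent (S A : Set Seq) : Prop :=
  A ⊆ S ∧ IsClosed A ∧ CompletelyInvariant S A ∧ IsTransitiveShift A ∧
    ∀ A' : Set Seq, A' ⊆ S → IsClosed A' → CompletelyInvariant S A' →
      (∃ x ∈ A', A' ⊆ closure (Set.range fun n => shift^[n] x)) → ¬A ⊂ A'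

/-- The exceptional set 𝓔: parameters a ≻ a* lying in no interval (ω0^∞, ω''')
for any i-irreducible word ω. -/
def exceptionalSet : Set Seq :=
  {a | lexLt astar a ∧ ∀ (i : ℕ) (ω : List Bool), IIrreducible i ω →
    ¬(lexLt (wordSeq ω) a ∧ lexLt a (triple ω))}

/-! ### Non-strict lexicographic order in universal form, tails and concatenations -/

/-- The tail of `x` starting at index `n`. -/
def tail (n : ℕ) (x : Seq) : Seq := fun i => x (n + i)

/-- The non-strict lexicographic order, in universal form. -/
def Below (x y : Seq) : Prop := ∀ t, (∀ r < t, x r = y r) → x t = true → y t = true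

/-- All tails of `x` lie between the mirror image of `a` and `a`, non-strictly. -/
def Bounded (a x : Seq) : Prop :=
  ∀ n, Below (tail n x) a ∧ Below (mirror (tail n x)) a

/-- The first `n` letters of `x` followed by `y`. -/
def cat (n : ℕ) (x y : Seq) : Seq := fun i => if i < n then x i else y (i - n)

/-- No proper suffix of the first `k` letters of `a` is the mirror image of a prefix of `a`,
and the `k`-th letter is `1`. -/
def Primitive (a : Seq) (k : ℕ) : Prop :=
  1 ≤ k ∧ a (k - 1) = true ∧ ∀ i, 0 < i → i < k → ∃ r, i + r < k ∧ a (i + r) = a r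

/-- `y` starts with the first `k` letters of `a`, the last one being replaced by `0`. -/
def Drops (a : Seq) (k : ℕ) (y : Seq) : Prop :=
  (∀ r < k - 1, y r = a r) ∧ y (k - 1) = false

/-- `z` is eventually alternating. -/
def EventuallyAlternating (z : Seq) : Prop := ∃ N, ∀ i ≥ N, z (i + 1) = !z i

/-- The sequence `a₁…a_k(ā₁…ā_{k-1}1)^∞`. -/
def reflected (a : Seq) (k : ℕ) : Seq := fun i =>
  if i < k then a i else if (i - k) % k = k - 1 then true else !a ((i - k) % k)

/-- The properties of the largest element of `Σ_ω` on which transitivity rests. -/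
structure IsUpperBound (a : Seq) : Prop where
  zero : a 0 = true
  one : a 1 = true
  self : Bounded a a
  reflect : ∀ k, 2 ≤ k → Primitive a k → ∃ M, ∀ z, (∀ i < M, z i = reflected a k i) →
    (∀ j, 0 < j → Below (tail j z) a) → (∀ j, Below (mirror (tail j z)) a) → Below z a

theorem mirror_mirror (x : Seq) : mirror (mirror x) = x := by
  funext i; simp [mirror]

theorem Bounded.to_mirror {a x : Seq} (h : Bounded a x) : Bounded a (mirror x) := by
  intro n
  refine ⟨(h n).2, ?_⟩
  have : mirror (tail n (mirror x)) = tail n x := by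
    funext i; simp [mirror, tail]
  rw [this]; exact (h n).1

theorem Bounded.to_tail {a x : Seq} (h : Bounded a x) (n : ℕ) : Bounded a (tail n x) := by
  intro j
  have : tail j (tail n x) = tail (n + j) x := by
    funext i; simp [tail, add_assoc]
  rw [this]; exact h _

theorem Bounded.upper {a x : Seq} (h : Bounded a x) (n t : ℕ)
    (e : ∀ r < t, x (n + r) = a r) (ht : x (n + t) = true) : a t = true :=
  (h n).1 t e ht

theorem Bounded.lower {a x : Seq} (h : Bounded a x) (n t : ℕ)
    (e : ∀ r < t, x (n + r) = !a r) (ht : x (n + t) = false) : a t = true :=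
  (h n).2 t (fun r hr => by simp [mirror, tail, e r hr]) (by simp [mirror, tail, ht])

theorem tail_cat_of_le {n j : ℕ} (x y : Seq) (h : j ≤ n) :
    tail j (cat n x y) = cat (n - j) (tail j x) y := by
  funext i
  simp only [tail, cat]
  by_cases h1 : j + i < n
  · rw [if_pos h1, if_pos (by omega)]
  · rw [if_neg h1, if_neg (by omega)]; congr 1; omega

theorem tail_cat_of_ge {n j : ℕ} (x y : Seq) (h : n ≤ j) :
    tail j (cat n x y) = tail (j - n) y := by
  funext i
  simp only [tail, cat]
  rw [if_neg (by omega)]; congr 1; omega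

theorem mirror_cat (n : ℕ) (x y : Seq) : mirror (cat n x y) = cat n (mirror x) (mirror y) := by
  funext i; simp only [mirror, cat]; split_ifs <;> rfl

theorem below_cat {n : ℕ} {x y a : Seq} (hx : Below x a)
    (hy : (∀ r < n, x r = a r) → Below y (tail n a)) : Below (cat n x y) a := by
  intro t e ht
  simp only [cat] at e ht
  by_cases h : t < n
  · rw [if_pos h] at ht
    refine hx t (fun r hr => ?_) ht
    have := e r hr
    rwa [if_pos (by omega)] at this
  · rw [if_neg h] at ht
    have h1 : ∀ r < n, x r = a r := fun r hr => by
      have := e r (by omega)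
      rwa [if_pos hr] at this
    have := hy h1 (t - n) (fun r hr => by
      have := e (n + r) (by omega)
      rw [if_neg (by omega)] at this
      simpa [tail] using this) ht
    rw [tail] at this
    rwa [show n + (t - n) = t by omega] at this

theorem Below.of_eqOn {x z a : Seq} {n : ℕ} (h : Below x a) (e : ∀ r < n, z r = x r)
    (hne : ∃ r < n, x r ≠ a r) : Below z a := by
  intro t ht1 ht2
  obtain ⟨r, hr, hr'⟩ := hne
  by_cases htr : r < t
  · exact absurd ((e r hr).symm.trans (ht1 r htr)) hr'
  · refine h t (fun r' hr' => ?_) ?_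
    · rw [← e r' (by omega)]; exact ht1 r' hr'
    · rw [← e t (by omega)]; exact ht2

theorem bounded_cat {a x y : Seq} {n : ℕ} (hy : Bounded a y)
    (h : ∀ j < n, Below (tail j (cat n x y)) a ∧ Below (mirror (tail j (cat n x y))) a) :
    Bounded a (cat n x y) := by
  intro j
  by_cases hj : j < n
  · exact h j hj
  · rw [tail_cat_of_ge x y (by omega)]; exact hy _

theorem EventuallyAlternating.to_mirror {z : Seq} (h : EventuallyAlternating z) :
    EventuallyAlternating (mirror z) := by
  obtain ⟨N, hN⟩ := h
  exact ⟨N, fun i hi => by simp [mirror, hN i hi]⟩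

theorem EventuallyAlternating.of_tail {z : Seq} {n : ℕ} (h : EventuallyAlternating (tail n z)) :
    EventuallyAlternating z := by
  obtain ⟨N, hN⟩ := h
  refine ⟨n + N, fun i hi => ?_⟩
  have := hN (i - n) (by omega)
  simp only [tail] at this
  rwa [show n + (i - n + 1) = i + 1 by omega, show n + (i - n) = i by omega] at this

theorem EventuallyAlternating.to_cat {z : Seq} (h : EventuallyAlternating z) (n : ℕ) (x : Seq) :
    EventuallyAlternating (cat n x z) := by
  apply EventuallyAlternating.of_tail (n := n)
  rw [tail_cat_of_ge x z le_rfl, Nat.sub_self]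
  obtain ⟨N, hN⟩ := h
  exact ⟨N, fun i hi => by simpa [tail] using hN i hi⟩

/-! ### Comparing tails of words built from prefixes of `a` -/

theorem Drops.below_tail {a z : Seq} {k : ℕ} (ha : Bounded a a) (hk : a (k - 1) = true)
    (hz : Drops a k z) {j : ℕ} (hj : j ≤ k - 1) : Below (tail j z) a := by
  intro t e ht
  simp only [tail] at e ht
  by_cases h1 : j + t < k - 1
  · refine ha.upper j t (fun r hr => ?_) ?_
    · rw [← hz.1 _ (by omega)]; exact e r hr
    · rw [← hz.1 _ h1]; exact ht
  · by_cases h2 : j + t = k - 1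
    · rw [h2, hz.2] at ht; cases ht
    · have h3 := e (k - 1 - j) (by omega)
      rw [show j + (k - 1 - j) = k - 1 by omega, hz.2] at h3
      have := ha.upper j (k - 1 - j) (fun r hr => by
        rw [← hz.1 _ (by omega)]; exact e r (by omega)) (by
          rwa [show j + (k - 1 - j) = k - 1 by omega])
      rw [this] at h3; cases h3

theorem Primitive.exists_first {a : Seq} {k : ℕ} (ha : Bounded a a) (hk : Primitive a k) {i : ℕ}
    (h0 : 0 < i) (hi : i < k) :
    ∃ r, i + r < k ∧ (∀ r' < r, a (i + r') = !a r') ∧ a (i + r) = true ∧ a r = true := by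
  have hex := hk.2.2 i h0 hi
  classical
  have hsp := Nat.find_spec hex
  have hmin : ∀ r' < Nat.find hex, a (i + r') = !a r' := fun r' hr' => by
    have := Nat.find_min hex hr'
    have h1 : ¬ a (i + r') = a r' := fun h => this ⟨by omega, h⟩
    revert h1; cases a (i + r') <;> cases a r' <;> simp
  refine ⟨Nat.find hex, hsp.1, hmin, ?_⟩
  have : a (Nat.find hex) = true := by
    cases h : a (i + Nat.find hex)
    · exact ha.lower i _ hmin h
    · rw [← hsp.2, h]
  exact ⟨hsp.2.trans this, this⟩

theorem Primitive.below_mirror_tail {a z : Seq} {k : ℕ} (ha : Bounded a a) (h0 : a 0 = true)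
    (hk : Primitive a k) (hz : ∀ r < k, z r = a r) {j : ℕ} (hj : j < k) :
    Below (mirror (tail j z)) a := by
  intro t e ht
  simp only [tail, mirror] at e ht
  by_cases hj0 : j = 0
  · subst hj0
    rcases Nat.eq_zero_or_pos t with rfl | h
    · exact h0
    · have := e 0 h
      rw [hz _ (by omega)] at this
      simp [h0] at this
  · obtain ⟨r, hr, h1, h2, h3⟩ := hk.exists_first ha (by omega) hj
    by_cases htr : r < t
    · have := e r htr
      rw [hz _ hr, h2, h3] at this; cases this
    · rcases Nat.lt_or_ge t r with h | h
      · have h4 := h1 t h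
        rw [hz _ (by omega), h4] at ht
        simpa using ht
      · have : t = r := by omega
        rw [this]; exact h3

theorem Primitive.below_tail_self {a q : Seq} {k : ℕ} (ha : Bounded a a)
    (hk : Primitive a k) (hq : ∀ r < k - 1, q r = !a r) {i : ℕ} (hi0 : 0 < i) (hi : i < k) :
    Below q (tail i a) := by
  obtain ⟨r, hr, h1, h2, h3⟩ := hk.exists_first ha hi0 hi
  intro t e ht
  simp only [tail] at e ⊢
  rcases Nat.lt_trichotomy t r with h | rfl | h
  · rw [h1 t h, ← hq t (by omega)]; exact ht
  · exact h2
  · have := e r h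
    rw [hq r (by omega), h2, h3] at this; cases this

/-- Prolonging the block `ā₁…ā_{k-1}1` in front of a sequence starting with it. -/
theorem bounded_cat_self {a q : Seq} {k : ℕ} (ha : Bounded a a) (h0 : a 0 = true) (h2 : 2 ≤ k)
    (hk : Primitive a k) (hq : Bounded a q) (hd : Drops a k (mirror q)) :
    Bounded a (cat k q q) ∧ Drops a k (mirror (cat k q q)) := by
  have hd' : Drops a k (mirror (cat k q q)) := by
    refine ⟨fun r hr => ?_, ?_⟩
    · rw [← hd.1 r hr]; simp only [mirror, cat]; rw [if_pos (by omega)]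
    · rw [← hd.2]; simp only [mirror, cat]; rw [if_pos (by omega)]
  have hqr : ∀ r < k - 1, q r = !a r := fun r hr => by
    have := hd.1 r hr
    rw [← this]; simp [mirror]
  refine ⟨bounded_cat hq fun j hj => ⟨?_, ?_⟩, hd'⟩
  · rw [tail_cat_of_le q q (by omega)]
    refine below_cat (hq j).1 fun e => ?_
    by_cases hj0 : j = 0
    · subst hj0
      have := e 0 (by omega)
      simp only [tail, add_zero] at this
      rw [hqr 0 (by omega), h0] at this; cases this
    · exact hk.below_tail_self ha hqr (by omega) (by omega)
  · exact hd'.below_tail ha hk.2.1 (by omega)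

theorem bounded_iterate_cat_self {a q : Seq} {k : ℕ} (ha : Bounded a a) (h0 : a 0 = true)
    (h2 : 2 ≤ k) (hk : Primitive a k) (hq : Bounded a q) (hd : Drops a k (mirror q)) (n : ℕ) :
    ∃ z N, Bounded a z ∧ Drops a k (mirror z) ∧ tail N z = q ∧
      ∀ i < n * k, z i = if i % k = k - 1 then true else !a (i % k) := by
  induction n with
  | zero => exact ⟨q, 0, hq, hd, by funext i; simp [tail], fun i hi => by omega⟩
  | succ n ih =>
    obtain ⟨z, N, hz, hzd, ht, hp⟩ := ih
    have := bounded_cat_self ha h0 h2 hk hz hzd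
    refine ⟨cat k z z, k + N, this.1, this.2, ?_, fun i hi => ?_⟩
    · rw [tail_cat_of_ge z z (by omega), Nat.add_sub_cancel_left, ht]
    · by_cases hik : i < k
      · rw [Nat.mod_eq_of_lt hik]
        simp only [cat]; rw [if_pos hik]
        split_ifs with h
        · have := hzd.2
          rw [h]; simpa [mirror] using this
        · have := hzd.1 i (by omega)
          rw [← this]; simp [mirror]
      · simp only [cat]; rw [if_neg hik, hp (i - k) (by rw [Nat.succ_mul] at hi; omega)]
        rw [← Nat.mod_eq_sub_mod (by omega)]

theorem IsUpperBound.exists_reflected {a q : Seq} {k : ℕ} (ha : IsUpperBound a) (h2 : 2 ≤ k)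
    (hk : Primitive a k) (hq : Bounded a q) (hd : Drops a k (mirror q)) :
    ∃ z N, Bounded a z ∧ (∀ r < k, z r = a r) ∧ Drops a k (mirror (tail k z)) ∧
      tail N z = q := by
  obtain ⟨M, hM⟩ := ha.reflect k h2 hk
  obtain ⟨y, N, hy, hyd, hyt, hyp⟩ := bounded_iterate_cat_self ha.self ha.zero h2 hk hq hd M
  have hza : ∀ r < k, cat k a y r = a r := fun r hr => by simp [cat, hr]
  have hyr : ∀ r < k - 1, y r = !a r := fun r hr => by
    rw [← hyd.1 r hr]; simp [mirror]
  have hlow : ∀ j, Below (mirror (tail j (cat k a y))) a := fun j => by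
    by_cases hj : j < k
    · exact hk.below_mirror_tail ha.self ha.zero hza hj
    · rw [tail_cat_of_ge a y (by omega)]; exact (hy _).2
  have hup : ∀ j, 0 < j → Below (tail j (cat k a y)) a := fun j hj0 => by
    by_cases hj : j < k
    · rw [tail_cat_of_le a y (by omega)]
      exact below_cat (ha.self j).1 fun _ => hk.below_tail_self ha.self hyr (by omega) (by omega)
    · rw [tail_cat_of_ge a y (by omega)]; exact (hy _).1
  refine ⟨cat k a y, k + N, fun j => ⟨?_, hlow j⟩, hza, ?_, ?_⟩
  · rcases Nat.eq_zero_or_pos j with rfl | hj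
    · have : tail 0 (cat k a y) = cat k a y := by funext i; simp [tail]
      rw [this]
      refine hM _ (fun i hi => ?_) hup hlow
      simp only [cat, reflected]
      by_cases hik : i < k
      · rw [if_pos hik, if_pos hik]
      · rw [if_neg hik, if_neg hik]
        exact hyp _ (by nlinarith [Nat.sub_le i k])
    · exact hup j hj
  · rw [tail_cat_of_ge a y le_rfl, Nat.sub_self]
    have : tail 0 y = y := by funext i; simp [tail]
    rwa [this]
  · rw [tail_cat_of_ge a y (by omega), Nat.add_sub_cancel_left, hyt]

theorem IsUpperBound.exists_drops {a : Seq} {k : ℕ} (ha : IsUpperBound a) (hk : Primitive a k) :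
    ∃ p, Bounded a p ∧ Drops a k p := by
  set b : Seq := fun i => if i = k - 1 then false else a i with hb
  have hk1 := hk.1
  have hd : Drops a k (cat k b a) := by
    refine ⟨fun r hr => ?_, ?_⟩
    · simp only [cat, hb]; rw [if_pos (by omega), if_neg (by omega)]
    · simp only [cat, hb]; rw [if_pos (by omega)]; simp
  refine ⟨cat k b a, bounded_cat ha.self fun j hj => ⟨hd.below_tail ha.self hk.2.1 (by omega), ?_⟩,
    hd⟩
  intro t e ht
  simp only [mirror, tail] at e ht
  have hlt : ∀ r, j + r < k - 1 → cat k b a (j + r) = a (j + r) := fun r hr => hd.1 _ hr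
  rcases Nat.lt_trichotomy (j + t) (k - 1) with h | h | h
  · rw [hlt t h] at ht
    exact ha.self.lower j t (fun r hr => by
      rw [← hlt r (by omega), ← e r hr]; simp) (by simpa using ht)
  · by_cases hj0 : j = 0
    · rcases Nat.eq_zero_or_pos t with rfl | ht0
      · exact ha.zero
      · have := e 0 ht0
        rw [hlt 0 (by omega), hj0] at this
        simp at this
    · obtain ⟨r, hr, h1⟩ := hk.2.2 j (by omega) hj
      by_cases hrt : r < t
      · have := e r hrt
        rw [hlt r (by omega), h1] at this
        simp at this
      · have hrt : r = t := by omega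
        rw [← hrt, ← h1, show j + r = k - 1 by omega]; exact hk.2.1
  · have hge : ∀ r, k ≤ j + r → cat k b a (j + r) = a (j + r - k) := fun r hr => by
      simp only [cat]; rw [if_neg (by omega)]
    have h1 : a (k - j + (j + t - k)) = true := by
      cases h1 : a (k - j + (j + t - k))
      · exfalso
        have := ha.self.lower (k - j) (j + t - k) (fun r hr => by
          have := e (k - j + r) (by omega)
          rw [hge _ (by omega), show j + (k - j + r) - k = r by omega] at this
          exact this.symm) h1
        rw [hge t (by omega), this] at ht; cases ht
      · rfl
    rwa [show k - j + (j + t - k) = t by omega] at h1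

theorem IsUpperBound.not_mirror_square {a : Seq} {k : ℕ} (ha : IsUpperBound a)
    (hk : Primitive a k) : ¬ ∀ r < k, a (k + r) = !a r := by
  intro h
  have hk1 := hk.1
  by_cases h2 : 2 ≤ k
  · obtain ⟨p, hp, hpd⟩ := ha.exists_drops hk
    obtain ⟨z, N, hz, hza, hzd, -⟩ := ha.exists_reflected h2 hk hp.to_mirror
      (by rwa [mirror_mirror])
    have h3 : a (k + (k - 1)) = true := by
      refine hz.upper 0 (k + (k - 1)) (fun r hr => ?_) ?_
      · rw [zero_add]
        by_cases hrk : r < k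
        · exact hza r hrk
        · have h4 := hzd.1 (r - k) (by omega)
          simp only [mirror, tail, show k + (r - k) = r by omega] at h4
          have h5 := h (r - k) (by omega)
          rw [show k + (r - k) = r by omega, ← h4] at h5
          simpa using h5.symm
      · have := hzd.2
        simpa [mirror, tail] using this
    rw [h _ (by omega), hk.2.1] at h3; cases h3
  · have : k = 1 := by omega
    subst this
    have := h 0 (by omega)
    simp [ha.zero, ha.one] at this

/-! ### Abundance of primitive prefixes and the descent along them -/

theorem IsUpperBound.tail_ne_mirror {a : Seq} (ha : IsUpperBound a) {i : ℕ} (hi : 0 < i)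
    (hmin : ∀ j, 0 < j → j < i → ∃ r, a (j + r) = a r) : ¬ ∀ r, a (i + r) = !a r := by
  intro h
  have h1 : a (i - 1) = true := by
    by_contra hf
    have hf : a (i - 1) = false := by simpa using hf
    have hall : ∀ r, a r = true := by
      intro r
      induction r using Nat.strong_induction_on with
      | _ r ih =>
        rcases r with _ | r
        · exact ha.zero
        · refine ha.self.lower (i - 1) (r + 1) (fun r' hr' => ?_) ?_
          · rcases r' with _ | r'
            · simp [hf, ha.zero]
            · rw [show i - 1 + (r' + 1) = i + r' by omega, h, ih _ hr', ih r' (by omega)]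
          · rw [show i - 1 + (r + 1) = i + r by omega, h, ih r (by omega)]; rfl
    rw [hall] at hf; cases hf
  refine ha.not_mirror_square ⟨hi, h1, fun j hj0 hj => ?_⟩ (fun r _ => h r)
  by_contra hne
  push Not at hne
  obtain ⟨r, hr1, hr2⟩ : ∃ r, a (j + r) = a r ∧ ∀ r' < r, a (j + r') = !a r' := by
    classical
    refine ⟨Nat.find (hmin j hj0 hj), Nat.find_spec (hmin j hj0 hj), fun r' hr' => ?_⟩
    have := Nat.find_min (hmin j hj0 hj) hr'
    revert this; cases a (j + r') <;> cases a r' <;> simp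
  have hrt : a r = true := by
    cases h3 : a (j + r)
    · exact ha.self.lower j r hr2 h3
    · rw [← hr1, h3]
  have hri : i ≤ j + r := by
    by_contra hlt
    exact hne r (by omega) hr1
  have h4 : a (j + r - i) = true := by
    refine ha.self.upper (i - j) (j + r - i) (fun r' hr' => ?_) ?_
    · have h5 := hr2 (i - j + r') (by omega)
      rw [show j + (i - j + r') = i + r' by omega, h r'] at h5
      simpa using h5.symm
    · rwa [show i - j + (j + r - i) = r by omega]
  have h6 := h (j + r - i)
  rw [show i + (j + r - i) = j + r by omega, hr1, hrt, h4] at h6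
  cases h6

theorem IsUpperBound.exists_primitive {a : Seq} (ha : IsUpperBound a) (l : ℕ) :
    ∃ k, l < k ∧ Primitive a k := by
  classical
  obtain ⟨k₀, hl, hk₀⟩ : ∃ k, l < k ∧ a (k - 1) = true := by
    by_contra hne
    push Not at hne
    have h0 : ∀ r, a (l + r) = false := fun r => by
      have := hne (l + r + 1) (by omega)
      simpa using this
    have hall : ∀ r, a r = true := by
      intro r
      induction r using Nat.strong_induction_on with
      | _ r ih => exact ha.self.lower l r (fun r' hr' => by rw [h0, ih r' hr']; rfl) (h0 r)
    have := h0 0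
    rw [hall] at this; cases this
  by_cases hp : Primitive a k₀
  · exact ⟨k₀, hl, hp⟩
  · have hex : ∃ i, 0 < i ∧ i < k₀ ∧ ∀ r, i + r < k₀ → a (i + r) ≠ a r := by
      by_contra hne
      push Not at hne
      exact hp ⟨by omega, hk₀, fun i h1 h2 => hne i h1 h2⟩
    obtain ⟨i, ⟨hi0, hik, hir⟩, hmin⟩ : ∃ i, (0 < i ∧ i < k₀ ∧ ∀ r, i + r < k₀ → a (i + r) ≠ a r) ∧
        ∀ j, 0 < j → j < i → ∃ r, j + r < k₀ ∧ a (j + r) = a r := by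
      refine ⟨Nat.find hex, Nat.find_spec hex, fun j hj0 hj => ?_⟩
      have := Nat.find_min hex hj
      have h2 := (Nat.find_spec hex).2.1
      push Not at this
      exact this hj0 (by omega)
    have hdev : ∃ r, a (i + r) = a r := by
      by_contra hne
      push Not at hne
      refine ha.tail_ne_mirror hi0 (fun j h1 h2 => (hmin j h1 h2).imp fun _ h => h.2) fun r => ?_
      have := hne r
      revert this; cases a (i + r) <;> cases a r <;> simp
    obtain ⟨r, hr1, hr2⟩ : ∃ r, a (i + r) = a r ∧ ∀ r' < r, a (i + r') = !a r' := by
      refine ⟨Nat.find hdev, Nat.find_spec hdev, fun r' hr' => ?_⟩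
      have := Nat.find_min hdev hr'
      revert this; cases a (i + r') <;> cases a r' <;> simp
    have hrt : a r = true := by
      cases h3 : a (i + r)
      · exact ha.self.lower i r hr2 h3
      · rw [← hr1, h3]
    have hri : k₀ ≤ i + r := by
      by_contra hlt
      exact hir r (by omega) hr1
    refine ⟨i + r + 1, by omega, by omega, ?_, fun j hj0 hj => ?_⟩
    · rw [Nat.add_sub_cancel, hr1, hrt]
    · rcases Nat.lt_trichotomy j i with h | rfl | h
      · obtain ⟨r', h1, h2⟩ := hmin j hj0 h
        exact ⟨r', by omega, h2⟩
      · exact ⟨r, by omega, hr1⟩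
      · by_contra hne
        push Not at hne
        have hne' : ∀ r', j + r' < i + r + 1 → a (j + r') = !a r' := fun r' h1 => by
          have := hne r' h1
          revert this; cases a (j + r') <;> cases a r' <;> simp
        have h4 : a (i + r - j) = true := by
          refine ha.self.upper (j - i) (i + r - j) (fun r' hr' => ?_) ?_
          · have h5 := hr2 (j - i + r') (by omega)
            rw [show i + (j - i + r') = j + r' by omega, hne' r' (by omega)] at h5
            simpa using h5.symm
          · rwa [show j - i + (i + r - j) = r by omega]
        have h5 := hne' (i + r - j) (by omega)
        rw [show j + (i + r - j) = i + r by omega, hr1, hrt, h4] at h5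
        cases h5

/-- The reflection recurrence of a primitive prefix. -/
theorem IsUpperBound.exists_recurrence {a : Seq} (ha : IsUpperBound a) {k : ℕ} (h2 : 2 ≤ k)
    (hk : Primitive a k) : ∃ s, s < k ∧ Primitive a s ∧ (∀ r < k - 1 - s, a (s + r) = !a r) ∧
      a (k - 1 - s) = true := by
  classical
  have hex : ∃ i, (0 < i ∧ i < k) ∧ (∀ r < k - 1 - i, a (i + r) = !a r) ∧ a (k - 1 - i) = true :=
    ⟨k - 1, by omega, fun r hr => by omega, by rw [Nat.sub_self]; exact ha.zero⟩
  obtain ⟨s, ⟨⟨hs0, hsk⟩, hsr, hsl⟩, hmin⟩ : ∃ s, ((0 < s ∧ s < k) ∧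
      (∀ r < k - 1 - s, a (s + r) = !a r) ∧ a (k - 1 - s) = true) ∧ ∀ j, 0 < j → j < s →
      ¬ ((∀ r < k - 1 - j, a (j + r) = !a r) ∧ a (k - 1 - j) = true) :=
    ⟨Nat.find hex, Nat.find_spec hex, fun j hj0 hj h => Nat.find_min hex hj
      ⟨⟨hj0, hj.trans (Nat.find_spec hex).1.2⟩, h⟩⟩
  have hlast : ∀ j, 0 < j → j < s → ¬ ∀ r < k - 1 - j, a (j + r) = !a r := by
    intro j hj0 hj h
    refine hmin j hj0 hj ⟨h, ?_⟩
    obtain ⟨r, hr1, hr2⟩ := hk.2.2 j hj0 (by omega)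
    by_cases hr : r < k - 1 - j
    · have := h r hr
      rw [hr2] at this
      simp at this
    · have : r = k - 1 - j := by omega
      rw [← this, ← hr2, show j + r = k - 1 by omega]; exact hk.2.1
  refine ⟨s, hsk, ⟨hs0, ?_, fun j hj0 hj => ?_⟩, hsr, hsl⟩
  · by_contra hf
    have hf : a (s - 1) = false := by simpa using hf
    have hs2 : s - 1 ≠ 0 := fun h => by rw [h, ha.zero] at hf; cases hf
    have hall : ∀ r < k - s, a r = true := by
      intro r
      induction r using Nat.strong_induction_on with
      | _ r ih =>
        intro hr
        rcases r with _ | r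
        · exact ha.zero
        · refine ha.self.lower (s - 1) (r + 1) (fun r' hr' => ?_) ?_
          · rcases r' with _ | r'
            · simp [hf, ha.zero]
            · rw [show s - 1 + (r' + 1) = s + r' by omega, hsr r' (by omega),
                ih _ hr' (by omega), ih r' (by omega) (by omega)]
          · rw [show s - 1 + (r + 1) = s + r by omega, hsr r (by omega),
              ih r (by omega) (by omega)]; rfl
    refine hlast (s - 1) (by omega) (by omega) fun r hr => ?_
    rw [hall r (by omega)]
    rcases r with _ | r
    · simpa using hf
    · rw [show s - 1 + (r + 1) = s + r by omega, hsr r (by omega), hall r (by omega)]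
  · by_contra hne
    push Not at hne
    refine hlast j hj0 hj ?_
    intro r
    induction r using Nat.strong_induction_on with
    | _ r ih =>
      intro hr
      by_contra hc
      have hc : a (j + r) = a r := by
        revert hc; cases a (j + r) <;> cases a r <;> simp
      have hr2 : ∀ r' < r, a (j + r') = !a r' := fun r' h => ih r' h (by omega)
      have hrt : a r = true := by
        cases h3 : a (j + r)
        · exact ha.self.lower j r hr2 h3
        · rw [← hc, h3]
      have hrs : s ≤ j + r := by
        by_contra hlt
        exact hne r (by omega) hc
      have h4 : a (j + r - s) = true := by
        refine ha.self.upper (s - j) (j + r - s) (fun r' hr' => ?_) ?_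
        · have h5 := hr2 (s - j + r') (by omega)
          rw [show j + (s - j + r') = s + r' by omega, hsr r' (by omega)] at h5
          simpa using h5.symm
        · rwa [show s - j + (j + r - s) = r by omega]
      have h6 := hsr (j + r - s) (by omega)
      rw [show s + (j + r - s) = j + r by omega, hc, hrt, h4] at h6
      cases h6

theorem IsUpperBound.bounded_tenSeq {a : Seq} (ha : IsUpperBound a) : Bounded a tenSeq := by
  intro n
  constructor
  · intro t e ht
    rcases t with _ | _ | t
    · exact ha.zero
    · exact ha.one
    · have h0 := e 0 (by omega)
      have h1 := e 1 (by omega)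
      simp only [tail, tenSeq, ha.zero, ha.one, decide_eq_true_eq] at h0 h1
      omega
  · intro t e ht
    rcases t with _ | _ | t
    · exact ha.zero
    · exact ha.one
    · have h0 := e 0 (by omega)
      have h1 := e 1 (by omega)
      simp only [mirror, tail, tenSeq, ha.zero, ha.one, Bool.not_eq_true', decide_eq_false_iff_not]
        at h0 h1
      omega

theorem eventuallyAlternating_tenSeq : EventuallyAlternating tenSeq := by
  refine ⟨0, fun i _ => ?_⟩
  simp only [tenSeq]
  rcases Nat.mod_two_eq_zero_or_one i with h | h
  · have : (i + 1) % 2 = 1 := by omega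
    simp [h, this]
  · have : (i + 1) % 2 = 0 := by omega
    simp [h, this]

theorem IsUpperBound.exists_drops_eventuallyAlternating {a : Seq} (ha : IsUpperBound a) (k : ℕ)
    (h2 : 2 ≤ k) (hk : Primitive a k) :
    ∃ z, Bounded a z ∧ Drops a k z ∧ EventuallyAlternating z := by
  induction k using Nat.strong_induction_on with
  | _ k ih =>
    obtain ⟨s, hsk, hs, hsr, hsl⟩ := ha.exists_recurrence h2 hk
    have hs1 := hs.1
    have hks : k ≤ 2 * s := by
      by_contra hlt
      exact ha.not_mirror_square hs fun r hr => hsr r (by omega)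
    by_cases hs2 : 2 ≤ s
    · obtain ⟨y, hy, hyr, hya⟩ : ∃ y, Bounded a y ∧ (∀ r < k - s, y r = !a r) ∧
          EventuallyAlternating y := by
        obtain ⟨z, hz, hzd, hza⟩ := ih s hsk hs2 hs
        by_cases hlt : k < 2 * s
        · exact ⟨mirror z, hz.to_mirror, fun r hr => by simp [mirror, hzd.1 r (by omega)], hza.to_mirror⟩
        · obtain ⟨y, N, hy, hyr, -, hyt⟩ := ha.exists_reflected hs2 hs hz.to_mirror
            (by rwa [mirror_mirror])
          refine ⟨mirror y, hy.to_mirror, fun r hr => by simp [mirror, hyr r (by omega)], ?_⟩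
          apply EventuallyAlternating.to_mirror
          apply EventuallyAlternating.of_tail (n := N)
          rw [hyt]; exact hza.to_mirror
      have hd : Drops a k (cat s a y) := by
        refine ⟨fun r hr => ?_, ?_⟩
        · simp only [cat]
          split_ifs with h
          · rfl
          · have := hsr (r - s) (by omega)
            rw [show s + (r - s) = r by omega] at this
            rw [hyr _ (by omega), this]
        · simp only [cat]
          rw [if_neg (by omega), hyr _ (by omega), hsl]; rfl
      refine ⟨cat s a y, bounded_cat hy fun j hj => ⟨hd.below_tail ha.self hk.2.1 (by omega), ?_⟩,
        hd, hya.to_cat s a⟩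
      exact hs.below_mirror_tail ha.self ha.zero (fun r hr => by simp [cat, hr]) hj
    · have hs' : s = 1 := by omega
      have hk' : k = 2 := by omega
      subst hk'
      refine ⟨tenSeq, ha.bounded_tenSeq, ⟨fun r hr => ?_, rfl⟩, eventuallyAlternating_tenSeq⟩
      have : r = 0 := by omega
      rw [this, ha.zero]; rfl

theorem IsUpperBound.extend_of_prefix {a x : Seq} (ha : IsUpperBound a) (hx : Bounded a x)
    {n p : ℕ} (hpn : p ≤ n) (hp : ∀ r < n - p, x (p + r) = a r)
    (hmin : ∀ j < p, (∃ r < n - j, x (j + r) ≠ a r) ∧ ∃ r < n - j, x (j + r) ≠ !a r) :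
    ∃ z, Bounded a z ∧ (∀ i < n, z i = x i) ∧ EventuallyAlternating z := by
  obtain ⟨k, hlk, hk⟩ := ha.exists_primitive (n - p + 1)
  obtain ⟨z, hz, hzd, hza⟩ := ha.exists_drops_eventuallyAlternating k (by omega) hk
  have hagree : ∀ i < n, cat p x z i = x i := fun i hi => by
    simp only [cat]
    split_ifs with h
    · rfl
    · have := hp (i - p) (by omega)
      rw [show p + (i - p) = i by omega] at this
      rw [hzd.1 _ (by omega), this]
  refine ⟨cat p x z, bounded_cat hz fun j hj => ⟨?_, ?_⟩, hagree, hza.to_cat p x⟩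
  · exact (hx j).1.of_eqOn (fun r hr => hagree (j + r) (by omega)) (hmin j hj).1
  · refine (hx j).2.of_eqOn (n := n - j) (fun r hr => ?_) ?_
    · simp only [mirror, tail]; rw [hagree (j + r) (by omega)]
    · obtain ⟨r, hr, h⟩ := (hmin j hj).2
      exact ⟨r, hr, fun h' => h (by rw [← h']; simp [mirror, tail])⟩

theorem IsUpperBound.extend {a x : Seq} (ha : IsUpperBound a) (hx : Bounded a x) (n : ℕ) :
    ∃ z, Bounded a z ∧ (∀ i < n, z i = x i) ∧ EventuallyAlternating z := by
  classical
  have hex : ∃ p, p ≤ n ∧ ((∀ r < n - p, x (p + r) = a r) ∨ ∀ r < n - p, x (p + r) = !a r) :=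
    ⟨n, le_rfl, Or.inl fun r hr => by omega⟩
  obtain ⟨hpn, hp⟩ := Nat.find_spec hex
  have hmin : ∀ j < Nat.find hex, (∃ r < n - j, x (j + r) ≠ a r) ∧
      ∃ r < n - j, x (j + r) ≠ !a r := by
    intro j hj
    have := Nat.find_min hex hj
    push Not at this
    exact this (by omega)
  rcases hp with hp | hp
  · exact ha.extend_of_prefix hx hpn hp hmin
  · obtain ⟨z, hz, hzx, hza⟩ := ha.extend_of_prefix hx.to_mirror hpn
      (fun r hr => by simp [mirror, hp r hr])
      (fun j hj => by
        obtain ⟨⟨r, hr, h1⟩, r', hr', h2⟩ := hmin j hj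
        refine ⟨⟨r', hr', fun h => h2 ?_⟩, r, hr, fun h => h1 ?_⟩
        · rw [← h]; simp [mirror]
        · simpa [mirror] using h)
    exact ⟨mirror z, hz.to_mirror, fun i hi => by simp [mirror, hzx i hi], hza.to_mirror⟩


/-! ### Alternating sequences in front of bounded ones -/

theorem Bounded.alternating {a y : Seq} (hy : Bounded a y) (h0 : a 0 = true) (h1 : a 1 = false)
    (i : ℕ) : y (i + 1) = !y i := by
  cases h : y i <;> cases h' : y (i + 1) <;> try rfl
  · have := hy.lower i 1 (fun r hr => by
      have : r = 0 := by omega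
      rw [this, h0]; exact h) h'
    rw [h1] at this; cases this
  · have := hy.upper i 1 (fun r hr => by
      have : r = 0 := by omega
      rw [this, h0]; exact h) h'
    rw [h1] at this; cases this

theorem Bounded.prepend {a y : Seq} (hy : Bounded a y) (h0 : a 0 = true)
    (hten : Bounded a tenSeq) : Bounded a (cat 1 (fun _ => !y 0) y) := by
  have key : ∀ y : Seq, Bounded a y → y 0 = false →
      Below (tail 0 (cat 1 (fun _ => !y 0) y)) a ∧
        Below (mirror (tail 0 (cat 1 (fun _ => !y 0) y))) a := by
    intro y hy hy0
    constructor
    · intro t e ht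
      simp only [tail, zero_add] at e ht
      rcases t with _ | _ | t
      · exact h0
      · simp [cat, hy0] at ht
      · have e1 := e 1 (by omega)
        simp only [cat, lt_self_iff_false, if_false, Nat.sub_self, hy0] at e1
        have halt : ∀ i, cat 1 (fun _ => !y 0) y i = tenSeq i := by
          intro i
          induction i with
          | zero => simp [cat, hy0, tenSeq]
          | succ i ih =>
            have h2 : tenSeq (i + 1) = !tenSeq i := by
              have := hten.alternating h0 e1.symm i
              exact this
            rw [h2, ← ih]
            rcases i with _ | i
            · simp [cat]
            · have := hy.alternating h0 e1.symm i
              simpa [cat] using this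
        exact hten.upper 0 (t + 2) (fun r hr => by rw [zero_add, ← halt, e r hr])
          (by rw [zero_add, ← halt, ht])
    · intro t e ht
      rcases t with _ | t
      · exact h0
      · have := e 0 (by omega)
        simp [mirror, tail, cat, hy0, h0] at this
  refine bounded_cat hy fun j hj => ?_
  have hj : j = 0 := by omega
  subst hj
  cases hy0 : y 0
  · have := key y hy hy0
    rwa [hy0] at this
  · have hm := key (mirror y) hy.to_mirror (by simp [mirror, hy0])
    have h3 : cat 1 (fun _ => !mirror y 0) (mirror y) = mirror (cat 1 (fun _ => !y 0) y) := by
      rw [mirror_cat]; rfl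
    rw [h3] at hm
    have h4 : tail 0 (mirror (cat 1 (fun _ => !y 0) y)) =
        mirror (tail 0 (cat 1 (fun _ => !y 0) y)) := rfl
    rw [h4, mirror_mirror, hy0] at hm
    exact hm.symm

theorem Bounded.exists_prepend {a y : Seq} (hy : Bounded a y) (h0 : a 0 = true)
    (hten : Bounded a tenSeq) (n : ℕ) :
    ∃ z, Bounded a z ∧ tail n z = y ∧ ∀ i < n, z (i + 1) = !z i := by
  induction n with
  | zero => exact ⟨y, hy, by funext i; simp [tail], fun i hi => by omega⟩
  | succ n ih =>
    obtain ⟨z, hz, hzt, hza⟩ := ih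
    refine ⟨_, hz.prepend h0 hten, ?_, fun i hi => ?_⟩
    · rw [tail_cat_of_ge _ _ (by omega), Nat.add_sub_cancel, hzt]
    · rcases i with _ | i
      · simp [cat]
      · simpa [cat] using hza i (by omega)

theorem Bounded.exists_prepend_of_head {a y : Seq} (hy : Bounded a y) (h0 : a 0 = true)
    (hten : Bounded a tenSeq) (n : ℕ) (b : Bool) :
    ∃ z N, n ≤ N ∧ Bounded a z ∧ tail N z = y ∧ z 0 = b ∧ ∀ i < n, z (i + 1) = !z i := by
  obtain ⟨z, hz, hzt, hza⟩ := hy.exists_prepend h0 hten n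
  by_cases hb : z 0 = b
  · exact ⟨z, n, le_rfl, hz, hzt, hb, hza⟩
  · refine ⟨_, n + 1, by omega, hz.prepend h0 hten, ?_, ?_, fun i hi => ?_⟩
    · rw [tail_cat_of_ge _ _ (by omega), Nat.add_sub_cancel, hzt]
    · revert hb; simp only [cat]; cases z 0 <;> cases b <;> simp
    · rcases i with _ | i
      · simp [cat]
      · simpa [cat] using hza i (by omega)

/-! ### The symmetric subshift of a finite word -/

theorem lexLt_iff {x y : Seq} :
    lexLt x y ↔ ∃ k, (∀ i < k, x i = y i) ∧ x k = false ∧ y k = true := by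
  simp only [lexLt, Bool.lt_iff]

theorem Below.trans_lexLt {x y z : Seq} (h : Below x y) (h' : lexLt y z) : lexLt x z := by
  classical
  rw [lexLt_iff] at h' ⊢
  obtain ⟨d, hd, hyd, hzd⟩ := h'
  by_cases hex : ∃ e, e ≤ d ∧ x e ≠ y e
  · obtain ⟨he, hne⟩ := Nat.find_spec hex
    have hmin : ∀ i < Nat.find hex, x i = y i := fun i hi => by
      have := Nat.find_min hex hi
      push Not at this
      exact this (by omega)
    have hxe : x (Nat.find hex) = false := by
      cases hx : x (Nat.find hex)
      · rfl
      · exact absurd (hx.trans (h _ hmin hx).symm) hne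
    have hye : y (Nat.find hex) = true := by
      revert hne; rw [hxe]; cases y (Nat.find hex) <;> simp
    have hlt : Nat.find hex ≠ d := fun h => by rw [h, hyd] at hye; cases hye
    exact ⟨_, fun i hi => (hmin i hi).trans (hd i (by omega)), hxe, by rw [← hd _ (by omega), hye]⟩
  · push Not at hex
    exact ⟨d, fun i hi => (hex i hi.le).trans (hd i hi), (hex d le_rfl).trans hyd, hzd⟩

theorem lexLt_wordSeq_congr {w : List Bool} {x z : Seq} (h : lexLt x (wordSeq w))
    (e : ∀ r < w.length, z r = x r) : lexLt z (wordSeq w) := by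
  rw [lexLt_iff] at h ⊢
  obtain ⟨d, hd, hx, hw⟩ := h
  have hdw : d < w.length := by
    by_contra hlt
    rw [wordSeq, List.getD_eq_default _ _ (not_lt.mp hlt)] at hw
    cases hw
  exact ⟨d, fun i hi => (e i (by omega)).trans (hd i hi), (e d hdw).trans hx, hw⟩

theorem shift_iterate (n : ℕ) (x : Seq) : shift^[n] x = tail n x := by
  induction n generalizing x with
  | zero => funext i; simp [tail]
  | succ n ih => rw [Function.iterate_succ_apply, ih]; funext i; simp [tail, shift]; congr 1; omega

theorem lexLt_mirror_comm {a x : Seq} : lexLt (mirror a) x ↔ lexLt (mirror x) a := by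
  simp only [lexLt_iff, mirror]
  refine exists_congr fun k => ?_
  have : (∀ i < k, (!a i) = x i) ↔ ∀ i < k, (!x i) = a i :=
    forall_congr' fun i => forall_congr' fun _ => by cases a i <;> cases x i <;> simp
  rw [this]
  cases a k <;> cases x k <;> simp

theorem mem_SigmaA {a x : Seq} :
    x ∈ SigmaA a ↔ ∀ n, lexLt (mirror (tail n x)) a ∧ lexLt (tail n x) a := by
  simp only [SigmaA, Set.mem_ofPred_eq, shift_iterate, lexLt_mirror_comm]

theorem tail_mem_SigmaA {a x : Seq} (hx : x ∈ SigmaA a) (n : ℕ) : tail n x ∈ SigmaA a := by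
  rw [mem_SigmaA] at hx ⊢
  intro j
  have : tail j (tail n x) = tail (n + j) x := by funext i; simp [tail, add_assoc]
  rw [this]; exact hx _

theorem mirror_mem_SigmaA {a x : Seq} (hx : x ∈ SigmaA a) : mirror x ∈ SigmaA a := by
  rw [mem_SigmaA] at hx ⊢
  intro j
  have : tail j (mirror x) = mirror (tail j x) := rfl
  rw [this, mirror_mirror]; exact (hx j).symm

theorem isSFT_SigmaA_wordSeq (w : List Bool) : IsSFT (SigmaA (wordSeq w)) := by
  classical
  set A : Set (List Bool) := {l | l.length = w.length ∧
    ¬ (lexLt (mirror (wordSeq l)) (wordSeq w) ∧ lexLt (wordSeq l) (wordSeq w))} with hA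
  have hfin : A.Finite := (List.finite_length_eq Bool w.length).subset fun l hl => hl.1
  refine ⟨hfin.toFinset, w.length, fun l hl => ((hfin.mem_toFinset).1 hl).1, ?_⟩
  ext x
  rw [mem_SigmaA]
  constructor
  · rintro hx l hl ⟨i, hi⟩
    obtain ⟨hlen, hl⟩ := (hfin.mem_toFinset).1 hl
    refine hl ⟨lexLt_wordSeq_congr (hx i).1 fun r hr => ?_, lexLt_wordSeq_congr (hx i).2 fun r hr => ?_⟩
    · simp only [mirror, tail, wordSeq]; rw [hi r (by omega)]
    · simp only [tail, wordSeq]; rw [hi r (by omega)]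
  · intro hx n
    set l := List.ofFn fun r : Fin w.length => x (n + r) with hl
    have hlen : l.length = w.length := by simp [hl]
    have hr : ∀ r < w.length, x (n + r) = l.getD r false := fun r hr => by
      rw [List.getD_eq_getElem _ _ (by omega)]; simp [hl]
    have hmem : l ∉ A := fun h => hx l ((hfin.mem_toFinset).2 h) ⟨n, fun j hj => hr j (by omega)⟩
    have h2 : lexLt (mirror (wordSeq l)) (wordSeq w) ∧ lexLt (wordSeq l) (wordSeq w) := by
      by_contra h; exact hmem ⟨hlen, h⟩
    exact ⟨lexLt_wordSeq_congr h2.1 fun r hr' => by simp only [mirror, tail, wordSeq]; rw [hr r hr'],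
      lexLt_wordSeq_congr h2.2 fun r hr' => by simp only [tail, wordSeq]; rw [hr r hr']⟩

theorem IsSFT.isClosed {S : Set Seq} (h : IsSFT S) : IsClosed S := by
  obtain ⟨F, n, -, rfl⟩ := h
  have : {x : Seq | ∀ w ∈ F, ¬ occursIn w x} =
      ⋂ w ∈ F, ⋂ i : ℕ, ⋃ j ∈ Set.Iio w.length, {x : Seq | x (i + j) ≠ w.getD j false} := by
    ext x; simp [occursIn]
  rw [this]
  refine isClosed_biInter fun w _ => isClosed_iInter fun i =>
    (Set.finite_Iio w.length).isClosed_biUnion fun j _ => ?_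
  have : IsClosed ((fun x : Seq => x (i + j)) ⁻¹' {b | b ≠ w.getD j false}) :=
    (isClosed_discrete _).preimage (continuous_apply _)
  exact this

theorem continuous_cantorFunction {c : ℝ} (h0 : 0 ≤ c) (h1 : c < 1) :
    Continuous (Cardinal.cantorFunction c) := by
  unfold Cardinal.cantorFunction
  refine continuous_tsum (u := fun n => c ^ n) (fun n => ?_)
    (summable_geometric_of_lt_one h0 h1) fun n f => ?_
  · have : (fun f : ℕ → Bool => Cardinal.cantorFunctionAux c f n) =
        (fun b : Bool => cond b (c ^ n) 0) ∘ fun f : ℕ → Bool => f n := rfl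
    rw [this]
    exact continuous_of_discreteTopology.comp (continuous_apply n)
  · simp only [Cardinal.cantorFunctionAux]
    cases f n
    · simpa using pow_nonneg h0 n
    · simp [abs_of_nonneg h0]

theorem exists_greatest {S : Set Seq} (hS : IsClosed S) (hne : S.Nonempty) :
    ∃ a ∈ S, ∀ x ∈ S, Below x a := by
  obtain ⟨a, ha, hmax⟩ := hS.isCompact.exists_isMaxOn hne
    (continuous_cantorFunction (c := 1 / 3) (by norm_num) (by norm_num)).continuousOn
  refine ⟨a, ha, fun x hx t e ht => ?_⟩
  by_contra hat
  have := Cardinal.increasing_cantorFunction (c := 1 / 3) (by norm_num) (by norm_num) (n := t)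
    (f := a) (g := x) (fun k hk => (e k hk).symm) (by simpa using hat) ht
  exact absurd (hmax hx) (not_le.mpr this)

theorem IrredWord.tenSeq_mem {w : List Bool} (h : IrredWord w) (hw : 2 ≤ w.length) :
    tenSeq ∈ SigmaA (wordSeq w) := by
  have hlt : lexLt tenSeq (wordSeq w) := by
    have := h.2.2.2 1 le_rfl (by omega) h.2.1
    rw [triple, if_pos (by simp)] at this
    exact this
  have hlt' : lexLt (mirror tenSeq) (wordSeq w) :=
    lexLt_iff.2 ⟨0, fun i hi => by omega, rfl, h.2.1⟩
  have hodd : ∀ n, tail n tenSeq = tenSeq ∨ tail n tenSeq = mirror tenSeq := by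
    intro n
    rcases Nat.mod_two_eq_zero_or_one n with hn | hn
    · left; funext i; simp only [tail, tenSeq]
      rw [show (n + i) % 2 = i % 2 by omega]
    · right; funext i; simp only [tail, tenSeq, mirror]
      rcases Nat.mod_two_eq_zero_or_one i with hi | hi
      · have : (n + i) % 2 = 1 := by omega
        simp [hi, this]
      · have : (n + i) % 2 = 0 := by omega
        simp [hi, this]
  rw [mem_SigmaA]
  intro n
  rcases hodd n with e | e <;> rw [e]
  · exact ⟨hlt', hlt⟩
  · rw [mirror_mirror]; exact ⟨hlt, hlt'⟩

theorem SigmaA_eq_bounded {b a : Seq} (ha : a ∈ SigmaA b) (hmax : ∀ x ∈ SigmaA b, Below x a)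
    {x : Seq} : x ∈ SigmaA b ↔ Bounded a x := by
  refine ⟨fun hx n => ⟨hmax _ (tail_mem_SigmaA hx n),
    hmax _ (mirror_mem_SigmaA (tail_mem_SigmaA hx n))⟩, fun hx => ?_⟩
  have hab : lexLt a b := by
    have := (mem_SigmaA.1 ha 0).2
    have h0 : tail 0 a = a := by funext i; simp [tail]
    rwa [h0] at this
  exact mem_SigmaA.2 fun n => ⟨(hx n).2.trans_lexLt hab, (hx n).1.trans_lexLt hab⟩

theorem IrredWord.isUpperBound {w : List Bool} (h : IrredWord w) {a : Seq}
    (ha : a ∈ SigmaA (wordSeq w)) (hmax : ∀ x ∈ SigmaA (wordSeq w), Below x a)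
    (h0 : a 0 = true) (h1 : a 1 = true) : IsUpperBound a := by
  have haw : lexLt a (wordSeq w) := by
    have := (mem_SigmaA.1 ha 0).2
    have h0 : tail 0 a = a := by funext i; simp [tail]
    rwa [h0] at this
  refine ⟨h0, h1, (SigmaA_eq_bounded ha hmax).1 ha, fun k h2 hk => ⟨w.length, fun z hz hup hlow => ?_⟩⟩
  refine hmax z (mem_SigmaA.2 fun j => ⟨(hlow j).trans_lexLt haw, ?_⟩)
  rcases Nat.eq_zero_or_pos j with rfl | hj
  · have hz0 : tail 0 z = z := by funext i; simp [tail]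
    rw [hz0]
    obtain ⟨d, hd, had, hwd⟩ := lexLt_iff.1 haw
    have hdw : d < w.length := by
      by_contra hlt
      rw [wordSeq, List.getD_eq_default _ _ (not_lt.mp hlt)] at hwd
      cases hwd
    by_cases hdk : d < k
    · have hza : ∀ i ≤ d, z i = a i := fun i hi => by
        rw [hz i (by omega), reflected, if_pos (by omega)]
      exact lexLt_iff.2 ⟨d, fun i hi => (hza i hi.le).trans (hd i hi), (hza d le_rfl).trans had, hwd⟩
    · have hwk : w.getD (k - 1) false = true := by
        have := hd (k - 1) (by omega)
        rw [hk.2.1] at this; exact this.symm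
      have hlt := h.2.2.2 k (by omega) (by omega) hwk
      refine lexLt_wordSeq_congr hlt fun r hr => ?_
      have hlen : (w.take k).length = k := by rw [List.length_take]; omega
      have htake : ∀ i < k, (w.take k).getD i false = a i := fun i hi => by
        rw [hd i (by omega), wordSeq, List.getD_eq_getElem _ _ (by omega),
          List.getD_eq_getElem _ _ (by omega), List.getElem_take]
      rw [hz r hr, reflected, triple, hlen, if_neg (show ¬ k ≤ 1 by omega)]
      by_cases hrk : r < k
      · rw [if_pos hrk, if_pos hrk, htake r hrk]
      · rw [if_neg hrk, if_neg hrk, htake _ (Nat.mod_lt _ (by omega : 0 < k))]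
  · exact (hup j hj).trans_lexLt haw

theorem Bounded.extend {w : List Bool} (h : IrredWord w) {a x : Seq}
    (ha : a ∈ SigmaA (wordSeq w)) (hmax : ∀ x ∈ SigmaA (wordSeq w), Below x a)
    (h0 : a 0 = true) (hx : Bounded a x) (n : ℕ) :
    ∃ z, Bounded a z ∧ (∀ i < n, z i = x i) ∧ EventuallyAlternating z := by
  cases h1 : a 1
  · exact ⟨x, hx, fun _ _ => rfl, 0, fun i _ => hx.alternating h0 h1 i⟩
  · exact (h.isUpperBound ha hmax h0 h1).extend hx n

/-- Words occurring in `S` at prescribed places of a single element can be bridged. -/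
theorem append_mem_lang {S : Set Seq} {u v : List Bool} {z : Seq} {N : ℕ} (hu : 1 ≤ u.length)
    (hz : z ∈ S) (hN : u.length ≤ N) (hzu : ∀ j < u.length, z j = u.getD j false)
    (hzv : ∀ j < v.length, z (N + j) = v.getD j false) :
    ∃ l : List Bool, u ++ l ++ v ∈ lang S := by
  refine ⟨List.ofFn fun r : Fin (N - u.length) => z (u.length + r), ?_, z, hz, 0, fun j hj => ?_⟩
  · simp only [List.length_append]; omega
  · simp only [List.length_append, List.length_ofFn] at hj
    rw [zero_add]
    by_cases h1 : j < u.length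
    · rw [hzu j h1, List.append_assoc, List.getD_append _ _ _ _ h1]
    · by_cases h2 : j < N
      · rw [List.getD_append _ _ _ _ (by simp; omega), List.getD_append_right _ _ _ _ (by omega),
          List.getD_eq_getElem _ _ (by simp; omega), List.getElem_ofFn]
        congr 1; simp only; omega
      · rw [List.getD_append_right _ _ _ _ (by simp; omega)]
        have := hzv (j - N) (by omega)
        rw [show N + (j - N) = j by omega] at this
        rw [this]; congr 1; simp; omega

theorem IrredWord.isTransitiveShift {w : List Bool} (h : IrredWord w) (hw : 2 ≤ w.length) :
    IsTransitiveShift (SigmaA (wordSeq w)) := by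
  have hten := h.tenSeq_mem hw
  obtain ⟨a, ha, hmax⟩ := exists_greatest (isSFT_SigmaA_wordSeq w).isClosed ⟨_, hten⟩
  have h0 : a 0 = true := hmax _ hten 0 (fun r hr => by omega) rfl
  have hiff : ∀ x, x ∈ SigmaA (wordSeq w) ↔ Bounded a x := fun x => SigmaA_eq_bounded ha hmax
  rintro u ⟨hu, x, hx, i, hi⟩ v ⟨hv, y, hy, j, hj⟩
  obtain ⟨z, hz, hzx, N₀, hN₀⟩ := Bounded.extend h ha hmax h0 (((hiff x).1 hx).to_tail i) u.length
  set N := max N₀ u.length with hN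
  have hN1 : N₀ ≤ N := le_max_left _ _
  have hN2 : u.length ≤ N := le_max_right _ _
  obtain ⟨y', L, hL, hy', hyt, hy0, hya⟩ := (((hiff y).1 hy).to_tail j).exists_prepend_of_head h0
    ((hiff _).1 hten) w.length (z N)
  have hglue : ∀ r ≤ w.length, y' r = z (N + r) := by
    intro r
    induction r with
    | zero => intro _; exact hy0
    | succ r ih =>
      intro hr
      rw [hya r (by omega), ih (by omega), ← add_assoc, hN₀ _ (by omega)]
  have hagree : ∀ r ≤ N + w.length, cat N z y' r = z r := fun r hr => by
    simp only [cat]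
    split_ifs with hrN
    · rfl
    · rw [hglue _ (by omega)]; congr 1; omega
  have hmem : cat N z y' ∈ SigmaA (wordSeq w) := by
    have hzS := mem_SigmaA.1 ((hiff z).2 hz)
    have hyS := mem_SigmaA.1 ((hiff y').2 hy')
    refine mem_SigmaA.2 fun n => ?_
    by_cases hn : n < N
    · refine ⟨lexLt_wordSeq_congr (hzS n).1 fun r hr => ?_,
        lexLt_wordSeq_congr (hzS n).2 fun r hr => ?_⟩
      · simp only [mirror, tail]; rw [hagree _ (by omega)]
      · simp only [tail]; rw [hagree _ (by omega)]
    · rw [tail_cat_of_ge z y' (by omega)]; exact hyS _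
  refine append_mem_lang (N := N + L) hu hmem (by omega) (fun r hr => ?_) fun r hr => ?_
  · rw [hagree r (by omega), hzx r hr]; exact hi r hr
  · have := congrFun hyt r
    simp only [tail] at this
    simp only [cat]
    rw [if_neg (by omega), show N + L + r - N = L + r by omega, this]; exact hj r hr

theorem SigmaA_wordSeq_eq_empty {w : List Bool} (hw : w.length ≤ 1) :
    SigmaA (wordSeq w) = ∅ := by
  refine Set.eq_empty_of_forall_notMem fun x hx => ?_
  have hlt : ∀ d, wordSeq w d = true → d = 0 := fun d hd => by
    by_contra hne
    rw [wordSeq, List.getD_eq_default w false (show w.length ≤ d by omega)] at hd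
    cases hd
  obtain ⟨⟨d, -, h1, h2⟩, e, -, h3, h4⟩ := (mem_SigmaA.1 hx 0).imp lexLt_iff.1 lexLt_iff.1
  rw [hlt d h2] at h1
  rw [hlt e h4] at h3
  simp [mirror, h3] at h1

/-- if w is irreducible then Sigma_w is a transitive subshift of
finite type. -/
theorem statement5 (w : List Bool) (h : IrredWord w) :
    IsTransitiveShift (SigmaA (wordSeq w)) ∧ IsSFT (SigmaA (wordSeq w)) := by
  refine ⟨?_, isSFT_SigmaA_wordSeq w⟩
  by_cases hw : 2 ≤ w.length
  · exact h.isTransitiveShift hw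
  · rintro u ⟨-, x, hx, -⟩
    rw [SigmaA_wordSeq_eq_empty (by omega)] at hx
    exact hx.elim

end Paper
end

section
/- Let a ∈ Σ₂ be an infinite sequence (a_i = 1 for infinitely many i) with (10)^∞ ≺ a ≺ 1^∞ and a₁ = 1. Let k₁ < k₂ < … enumerate all indices k with a_k = 1, and for each n let a⁻_n = a₁…a_{k_n}0^∞ ∈ Σ₂ be the finite sequence obtained by truncating a at its n-th digit equal to 1. Then for every m ∈ ℕ there exists N ∈ ℕ such that B_m(Σ_{a⁻_n}) = B_m(Σ_{a⁻_N}) = B_m(Σ_a) for every n ≥ N. -/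
open Filter Topology

namespace Paper

/-- The reflected window of `x` at position `i` (mirrored when `x i = false`, so that it starts
with `true`) first differs from `b` at index `d`, where it is smaller. -/
def DropsAt (b x : Seq) (i d : ℕ) : Prop :=
  (∀ t < d, (x (i + t) == x i) = b t) ∧ (x (i + d) == x i) = false ∧ b d = true

theorem iterate_shift_apply (n : ℕ) (x : Seq) (i : ℕ) : shift^[n] x i = x (n + i) := by
  induction n generalizing x with
  | zero => simp
  | succ n ih =>
    rw [Function.iterate_succ_apply, ih]
    simp only [shift]
    congr 1
    omega

theorem mem_SigmaA_iff {b : Seq} (hb : b 0 = true) (x : Seq) :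
    x ∈ SigmaA b ↔ ∀ i, ∃ d, DropsAt b x i d := by
  simp only [SigmaA, Set.mem_ofPred_eq]
  refine forall_congr' fun i => ?_
  simp only [lexLt, iterate_shift_apply, mirror, Bool.lt_iff, DropsAt]
  cases hx : x i
  · constructor
    · rintro ⟨⟨d, h, h'⟩, -⟩
      exact ⟨d, fun t ht => by simp [← h t ht], by simp [h'.2], by simpa using h'.1⟩
    · rintro ⟨d, h, h', h''⟩
      exact ⟨⟨d, fun t ht => by simp [← h t ht], by simpa using h'', by simpa using h'⟩,
        ⟨0, by simp, by simpa using hx, hb⟩⟩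
  · constructor
    · rintro ⟨-, ⟨d, h, h'⟩⟩
      exact ⟨d, fun t ht => by simp [← h t ht], by simp [h'.1], h'.2⟩
    · rintro ⟨d, h, h', h''⟩
      exact ⟨⟨0, by simp, by simpa using hb, by simpa using hx⟩,
        ⟨d, fun t ht => by simp [← h t ht], by simpa using h', h''⟩⟩

/-- The sequence equal to `x` before `q` and satisfying `y (j + r) = c xor y j` from then on,
where `r` is positive. -/
def splice (x : Seq) (q r : ℕ) (hr : 0 < r) (c : Bool) : Seq := fun j =>
  if j < q ∨ j < r then x j else xor c (splice x q r hr c (j - r))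
termination_by j => j

/-- Every point of the subshift can be approximated by sequences whose windows agree with the
parameter on prefixes of bounded length only. -/
theorem exists_bounded_dropsAt {b x : Seq} (hx : ∀ i, ∃ d, DropsAt b x i d) (m : ℕ) :
    ∃ (y : Seq) (p : ℕ), (∀ j < m, y j = x j) ∧ ∀ i, ∃ d ≤ p, DropsAt b y i d := by
  choose d hd using hx
  obtain ⟨s, hs, hmax⟩ := Finset.exists_max_image (Finset.range (m + 1)) d ⟨0, by simp⟩
  simp only [Finset.mem_range] at hs hmax
  by_cases hbdd : ∀ i, d i ≤ d s
  · exact ⟨x, d s, fun _ _ => rfl, fun i => ⟨d i, hbdd i, hd i⟩⟩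
  push Not at hbdd
  classical
  obtain ⟨q, hq, hlt⟩ : ∃ q, d s < d q ∧ ∀ i < q, d i ≤ d s :=
    ⟨Nat.find hbdd, Nat.find_spec hbdd, fun i hi => not_lt.1 (Nat.find_min hbdd hi)⟩
  have hmq : m < q := by
    by_contra h
    exact absurd (hmax q (by omega)) (by omega)
  have hr : 0 < q - s := by omega
  set c : Bool := xor (x q) (x s) with hc
  set y : Seq := splice x q (q - s) hr c with hy
  have y_of_lt : ∀ j < q, y j = x j := fun j hj => by
    rw [hy, splice, if_pos (Or.inl hj)]
  have y_of_ge : ∀ j, q ≤ j → y j = xor c (y (j - (q - s))) := fun j hj => by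
    rw [hy, splice, if_neg (by omega)]
  have agree : ∀ j < q + d s, y j = x j := by
    intro j
    induction j using Nat.strong_induction_on with
    | _ j ih =>
      intro hj
      rcases lt_or_ge j q with hjq | hjq
      · exact y_of_lt j hjq
      · obtain ⟨t, rfl⟩ := Nat.exists_eq_add_of_le hjq
        have e : q + t - (q - s) = s + t := by omega
        rw [y_of_ge _ hjq, e, ih (s + t) (by omega) (by omega)]
        have h1 := (hd s).1 t (by omega)
        have h2 := (hd q).1 t (by omega)
        rw [← h2] at h1
        rw [hc]
        revert h1
        cases x (s + t) <;> cases x s <;> cases x (q + t) <;> cases x q <;> decide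
  refine ⟨y, d s, fun j hj => y_of_lt j (by omega), fun i => ?_⟩
  induction i using Nat.strong_induction_on with
  | _ i ih =>
    rcases lt_or_ge i q with hiq | hiq
    · have hle := hlt i hiq
      obtain ⟨h1, h2, h3⟩ := hd i
      refine ⟨d i, hle, fun t ht => ?_, ?_, h3⟩
      · rw [agree _ (by omega), y_of_lt i hiq]
        exact h1 t ht
      · rw [agree _ (by omega), y_of_lt i hiq]
        exact h2
    · obtain ⟨e, he, h1, h2, h3⟩ := ih (i - (q - s)) (by omega)
      have key : ∀ t, (y (i + t) == y i) = (y (i - (q - s) + t) == y (i - (q - s))) := by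
        intro t
        rw [y_of_ge i hiq, y_of_ge (i + t) (by omega),
          show i + t - (q - s) = i - (q - s) + t by omega]
        cases c <;> cases y (i - (q - s) + t) <;> cases y (i - (q - s)) <;> rfl
      exact ⟨e, he, fun t ht => (key t).trans (h1 t ht), (key e).trans h2, h3⟩

theorem SigmaA_truncate_subset {a : Seq} (ha : a 0 = true) (l : ℕ) :
    SigmaA (fun i => if i ≤ l then a i else false) ⊆ SigmaA a := by
  intro x hx
  rw [mem_SigmaA_iff (by simpa using ha)] at hx
  rw [mem_SigmaA_iff ha]
  intro i
  obtain ⟨d, h1, h2, h3⟩ := hx i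
  have hdl : d ≤ l := by
    by_contra h
    simp [h] at h3
  refine ⟨d, fun t ht => ?_, h2, by simpa [hdl] using h3⟩
  exact (h1 t ht).trans (if_pos (by omega))

theorem Bword_mono {S T : Set Seq} (h : S ⊆ T) (m : ℕ) : Bword S m ⊆ Bword T m :=
  fun _ ⟨hw, x, hx, ho⟩ => ⟨hw, x, h hx, ho⟩

theorem exists_forall_mem_Bword_truncate {a : Seq} (ha : a 0 = true) {m : ℕ} {w : List Bool}
    (hw : w ∈ Bword (SigmaA a) m) :
    ∃ p, ∀ l ≥ p, w ∈ Bword (SigmaA (fun i => if i ≤ l then a i else false)) m := by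
  obtain ⟨hlen, x, hx, i₀, hocc⟩ := hw
  rw [mem_SigmaA_iff ha] at hx
  obtain ⟨y, p, hyx, hy⟩ := exists_bounded_dropsAt hx (i₀ + m)
  refine ⟨p, fun l hl => ⟨hlen, y, ?_, i₀, fun j hj => ?_⟩⟩
  · rw [mem_SigmaA_iff (by simpa using ha)]
    intro i
    obtain ⟨d, hd, h1, h2, h3⟩ := hy i
    refine ⟨d, fun t ht => ?_, h2, ?_⟩
    · exact (h1 t ht).trans (if_pos (by omega)).symm
    · exact (if_pos (by omega)).trans h3
  · rw [hyx _ (by omega), hocc j hj]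

/-- stability of B_m under the canonical approximation from below,
where the n-th approximation truncates a right after its n-th digit 1. -/
theorem statement14 (a : Seq) (hinf : ∀ N, ∃ i ≥ N, a i = true)
    (h1 : lexLt tenSeq a) (h2 : lexLt a (fun _ => true)) (ha0 : a 0 = true)
    (k : ℕ → ℕ) (hk : StrictMono k) (hk1 : ∀ n, a (k n) = true)
    (hkall : ∀ j, a j = true → ∃ n, k n = j) :
    ∀ m : ℕ, ∃ N : ℕ, ∀ n ≥ N,
      Bword (SigmaA (fun i => if i ≤ k n then a i else false)) m
          = Bword (SigmaA a) m ∧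
      Bword (SigmaA (fun i => if i ≤ k N then a i else false)) m
          = Bword (SigmaA a) m := by
  intro m
  have hfin : (Bword (SigmaA a) m).Finite :=
    (List.finite_length_eq Bool m).subset fun w hw => hw.1
  have hev : ∀ᶠ n in atTop, ∀ w ∈ Bword (SigmaA a) m,
      w ∈ Bword (SigmaA (fun i => if i ≤ k n then a i else false)) m := by
    rw [eventually_all_finite hfin]
    intro w hw
    obtain ⟨p, hp⟩ := exists_forall_mem_Bword_truncate ha0 hw
    exact eventually_atTop.2 ⟨p, fun n hn => hp _ (hn.trans hk.le_apply)⟩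
  obtain ⟨N, hN⟩ := eventually_atTop.1 hev
  have heq : ∀ n ≥ N, Bword (SigmaA (fun i => if i ≤ k n then a i else false)) m
      = Bword (SigmaA a) m := fun n hn =>
    (Bword_mono (SigmaA_truncate_subset ha0 _) m).antisymm (hN n hn)
  exact ⟨N, fun n hn => ⟨heq n hn, heq N le_rfl⟩⟩

end Paper
end
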